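/- arXiv:2211.12204 — 2 statements merged into one kernel-verified Lean document; each statement's English description precedes it below -/
import Mathlib

section
/- For every n ≥ 8, r̃(𝒞, Pn) = 2n − 2, where r̃(𝒞, Pn) is the least m such that Builder can force, within m rounds, the graph of red edges to contain a cycle (of any length at least 3) or the graph of blue edges to contain a path on n vertices. That is: Builder has a strategy forcing a red cycle or a blue Pn within 2n − 2 rounds, and for every Builder strategy there exists a Painter strategy keeping the red graph acyclic and the blue graph free of any path on n vertices for 2n − 3 rounds. -/
/-!
The online size Ramsey game on `K_ℕ`: in each round Builder selects a previously
unselected edge and Painter colours it red (`true`) or blue (`false`).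
-/

namespace OnlineRamsey

abbrev Edge := Sym2 ℕ
abbrev History := List (Edge × Bool)   -- `true` = red, `false` = blue
abbrev BuilderStrat := History → Edge
abbrev PainterStrat := History → Edge → Bool

/-- The history of the game after `t` rounds, when Builder follows `B` and
Painter follows `P`. -/
def gamePlay (B : BuilderStrat) (P : PainterStrat) : ℕ → History
  | 0 => []
  | t + 1 =>
      let h := gamePlay B P t
      h ++ [(B h, P h (B h))]

def redSet (h : History) : Set Edge := {e | (e, true) ∈ h}
def blueSet (h : History) : Set Edge := {e | (e, false) ∈ h}
def chosenSet (h : History) : Set Edge := {e | ∃ c, (e, c) ∈ h}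

def redGraph (h : History) : SimpleGraph ℕ := SimpleGraph.fromEdgeSet (redSet h)
def blueGraph (h : History) : SimpleGraph ℕ := SimpleGraph.fromEdgeSet (blueSet h)

/-- `H` contains a copy of `G`. -/
def HasCopy {α β : Type} (G : SimpleGraph α) (H : SimpleGraph β) : Prop :=
  ∃ f : G →g H, Function.Injective f

/-- During the first `m` rounds Builder always selects a previously unselected
(non-loop) edge, whatever Painter does. -/
def BuilderLegal (B : BuilderStrat) (m : ℕ) : Prop :=
  ∀ P : PainterStrat, ∀ t < m,
    ¬ (B (gamePlay B P t)).IsDiag ∧ B (gamePlay B P t) ∉ chosenSet (gamePlay B P t)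

/-- Builder can force, within `m` rounds, the red graph to contain a copy of `G`
or the blue graph to contain a copy of `H`. -/
def BuilderForces {α β : Type} (G : SimpleGraph α) (H : SimpleGraph β) (m : ℕ) : Prop :=
  ∃ B : BuilderStrat, BuilderLegal B m ∧
    ∀ P : PainterStrat, ∃ t ≤ m,
      HasCopy G (redGraph (gamePlay B P t)) ∨ HasCopy H (blueGraph (gamePlay B P t))

/-! ### Basic facts about histories -/

/-- `x y` is a blue edge of the history. -/
def Bl (h : History) (x y : ℕ) : Prop := (s(x, y), false) ∈ h

/-- `x` and `y` are in the same red component. -/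
def Re (h : History) (x y : ℕ) : Prop := (redGraph h).Reachable x y

/-- `x y` has not been selected yet. -/
def Free (h : History) (x y : ℕ) : Prop := ∀ c, (s(x, y), c) ∉ h

/-- The vertex `y` is not touched by the history. -/
def Fresh (h : History) (y : ℕ) : Prop := ∀ z, Free h y z

theorem Bl.symm {h : History} {x y : ℕ} (H : Bl h x y) : Bl h y x := by
  unfold Bl at *; rwa [Sym2.eq_swap]

theorem Bl.mono {h : History} {x y : ℕ} (H : Bl h x y) (e : Edge × Bool) :
    Bl (h ++ [e]) x y := by
  unfold Bl at *; simp [H]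

theorem Bl.new (h : History) (x y : ℕ) : Bl (h ++ [(s(x, y), false)]) x y := by
  unfold Bl; simp

theorem redGraph_mono (h : History) (e : Edge × Bool) : redGraph h ≤ redGraph (h ++ [e]) := by
  apply SimpleGraph.fromEdgeSet_mono
  intro x hx
  simp only [redSet, Set.mem_ofPred_eq, List.mem_append] at *
  exact Or.inl hx

theorem Re.symm {h : History} {x y : ℕ} (H : Re h x y) : Re h y x :=
  SimpleGraph.Reachable.symm H

theorem Re.trans {h : History} {x y z : ℕ} (H : Re h x y) (H' : Re h y z) : Re h x z :=
  SimpleGraph.Reachable.trans H H'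

theorem Re.mono {h : History} {x y : ℕ} (H : Re h x y) (e : Edge × Bool) :
    Re (h ++ [e]) x y :=
  SimpleGraph.Reachable.mono (redGraph_mono h e) H

theorem Re.of_mem {h : History} {x y : ℕ} (H : (s(x, y), true) ∈ h) : Re h x y := by
  by_cases hxy : x = y
  · subst hxy; exact SimpleGraph.Reachable.refl _
  · apply SimpleGraph.Adj.reachable
    simp [redGraph, redSet, H, hxy]

theorem Re.new (h : History) (x y : ℕ) : Re (h ++ [(s(x, y), true)]) x y :=
  Re.of_mem (by simp)

theorem Free.symm {h : History} {x y : ℕ} (H : Free h x y) : Free h y x := by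
  intro c; rw [Sym2.eq_swap]; exact H c

theorem Free.append {h : History} {x y a b : ℕ} {c : Bool} (H : Free h x y)
    (hne : s(x, y) ≠ s(a, b)) : Free (h ++ [(s(a, b), c)]) x y := by
  intro c' hc
  simp only [List.mem_append, List.mem_singleton, Prod.mk.injEq] at hc
  rcases hc with hc | hc
  · exact H _ hc
  · exact hne hc.1

theorem Fresh.append {h : History} {y a b : ℕ} {c : Bool} (H : Fresh h y)
    (ha : y ≠ a) (hb : y ≠ b) : Fresh (h ++ [(s(a, b), c)]) y := by
  intro z
  refine (H z).append ?_
  intro he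
  have : y ∈ s(a, b) := by rw [← he]; simp
  simp at this
  tauto

theorem exists_fresh (h : History) (l : List ℕ) : ∃ y, y ∉ l ∧ Fresh h y := by
  induction h generalizing l with
  | nil =>
    obtain ⟨y, hy⟩ := Infinite.exists_notMem_finset l.toFinset
    exact ⟨y, by simpa using hy, fun z c => by simp⟩
  | cons e h ih =>
    obtain ⟨⟨a, b⟩, c⟩ := e
    obtain ⟨y, hy, hf⟩ := ih (a :: b :: l)
    simp only [List.mem_cons, not_or] at hy
    refine ⟨y, hy.2.2, fun z c' hc => ?_⟩
    simp only [List.mem_cons] at hc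
    rcases hc with hc | hc
    · have h1 := congrArg Prod.fst hc
      have : y ∈ s(a, b) := by
        have h2 : s(y, z) = s(a, b) := h1
        rw [← h2]; simp
      simp at this
      tauto
    · exact hf z c' hc

/-! ### Winning positions -/

def Won (n : ℕ) (h : History) : Prop :=
  ¬ (redGraph h).IsAcyclic ∨ HasCopy (SimpleGraph.pathGraph n) (blueGraph h)

/-- Builder can win from the position `h` within `m` further rounds. -/
def CanWin (n : ℕ) : ℕ → History → Prop
  | 0, h => Won n h
  | m + 1, h => Won n h ∨ ∃ e : Edge, ¬ e.IsDiag ∧ e ∉ chosenSet h ∧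
      ∀ c, CanWin n m (h ++ [(e, c)])

theorem Won.canWin {n : ℕ} {h : History} (H : Won n h) (m : ℕ) : CanWin n m h := by
  cases m with
  | zero => exact H
  | succ m => exact Or.inl H

theorem CanWin.move {n m : ℕ} {h : History} (x y : ℕ) (hxy : x ≠ y) (hf : Free h x y)
    (hr : CanWin n m (h ++ [(s(x, y), true)])) (hb : CanWin n m (h ++ [(s(x, y), false)])) :
    CanWin n (m + 1) h := by
  refine Or.inr ⟨s(x, y), by simpa using hxy, ?_, ?_⟩
  · rintro ⟨c, hc⟩; exact hf c hc
  · intro c; cases c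
    · exact hb
    · exact hr

theorem won_of_red {n : ℕ} {h : History} {x y : ℕ} (hxy : x ≠ y) (hf : Free h x y)
    (hR : Re h x y) : Won n (h ++ [(s(x, y), true)]) := by
  left
  intro hac
  rw [SimpleGraph.isAcyclic_iff_forall_adj_isBridge] at hac
  have hadj : (redGraph (h ++ [(s(x, y), true)])).Adj x y := by
    simp [redGraph, redSet, hxy]
  have := hac hadj
  rw [SimpleGraph.isBridge_iff] at this
  apply this
  refine SimpleGraph.Reachable.mono ?_ hR
  intro a b hab
  simp only [SimpleGraph.deleteEdges_adj, Set.mem_singleton_iff]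
  refine ⟨redGraph_mono h _ hab, ?_⟩
  intro he
  have h2 : (s(a, b), true) ∈ h := by
    have := hab
    simp only [redGraph, SimpleGraph.fromEdgeSet_adj, redSet, Set.mem_ofPred_eq] at this
    exact this.1
  rw [he] at h2
  exact hf _ h2

theorem CanWin.forced {n m : ℕ} {h : History} (x y : ℕ) (hxy : x ≠ y) (hf : Free h x y)
    (hR : Re h x y) (hb : CanWin n m (h ++ [(s(x, y), false)])) :
    CanWin n (m + 1) h :=
  CanWin.move x y hxy hf ((won_of_red hxy hf hR).canWin m) hb

open Classical in
/-- The strategy of Builder read off from `CanWin`. -/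
noncomputable def bstrat (n m : ℕ) : BuilderStrat := fun h =>
  if H : ∃ e : Edge, (¬ e.IsDiag ∧ e ∉ chosenSet h) ∧
      ∀ c, CanWin n (m - h.length - 1) (h ++ [(e, c)]) then H.choose
  else s((exists_fresh h []).choose, (exists_fresh h []).choose + 1)

theorem bstrat_legal (n m : ℕ) (h : History) :
    ¬ (bstrat n m h).IsDiag ∧ bstrat n m h ∉ chosenSet h := by
  unfold bstrat
  split_ifs with H
  · exact H.choose_spec.1
  · refine ⟨by simp, ?_⟩
    rintro ⟨c, hc⟩
    exact (exists_fresh h []).choose_spec.2 _ _ hc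

theorem bstrat_spec (n m : ℕ) (h : History) (H : ∃ e : Edge, (¬ e.IsDiag ∧ e ∉ chosenSet h) ∧
    ∀ c, CanWin n (m - h.length - 1) (h ++ [(e, c)])) (c : Bool) :
    CanWin n (m - h.length - 1) (h ++ [(bstrat n m h, c)]) := by
  unfold bstrat
  rw [dif_pos H]
  exact H.choose_spec.2 c

theorem gamePlay_length (B : BuilderStrat) (P : PainterStrat) (t : ℕ) :
    (gamePlay B P t).length = t := by
  induction t with
  | zero => rfl
  | succ t ih => simp [gamePlay, ih]

theorem bstrat_wins (n m : ℕ) (H : CanWin n m []) (P : PainterStrat) :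
    ∃ t ≤ m, Won n (gamePlay (bstrat n m) P t) := by
  by_contra! hcon
  have key : ∀ t ≤ m, CanWin n (m - t) (gamePlay (bstrat n m) P t) := by
    intro t
    induction t with
    | zero => intro _; exact H
    | succ t ih =>
      intro ht
      have h1 := ih (by omega)
      have h2 : m - t = (m - (t + 1)) + 1 := by omega
      rw [h2] at h1
      rcases h1 with h1 | ⟨e, he1, he2, he3⟩
      · exact absurd h1 (hcon t (by omega))
      · have hl := gamePlay_length (bstrat n m) P t
        have hex : ∃ e : Edge, (¬ e.IsDiag ∧ e ∉ chosenSet (gamePlay (bstrat n m) P t)) ∧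
            ∀ c, CanWin n (m - (gamePlay (bstrat n m) P t).length - 1)
              (gamePlay (bstrat n m) P t ++ [(e, c)]) := by
          refine ⟨e, ⟨he1, he2⟩, ?_⟩
          rw [hl]; exact he3
        have h3 := bstrat_spec n m _ hex
        rw [hl] at h3
        exact h3 _
  have := key m le_rfl
  rw [Nat.sub_self] at this
  exact hcon m le_rfl this

/-! ### Blue paths -/

/-- `l` is a blue path from `u` to `v`. -/
structure Pth (h : History) (l : List ℕ) (u v : ℕ) : Prop where
  nodup : l.Nodup
  chain : l.IsChain (Bl h)
  head : l.head? = some u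
  last : l.getLast? = some v

theorem Pth.mono {h : History} {l : List ℕ} {u v : ℕ} (H : Pth h l u v) (e : Edge × Bool) :
    Pth (h ++ [e]) l u v :=
  ⟨H.nodup, H.chain.imp (fun _ _ hb => hb.mono e), H.head, H.last⟩

theorem Pth.cons {h : History} {l : List ℕ} {u v y : ℕ} (H : Pth h l u v) (hy : y ∉ l)
    (hb : Bl h y u) : Pth h (y :: l) y v := by
  refine ⟨List.nodup_cons.2 ⟨hy, H.nodup⟩, ?_, rfl, ?_⟩
  · rw [List.isChain_cons]
    refine ⟨?_, H.chain⟩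
    intro z hz
    rw [H.head] at hz
    simp at hz; subst hz; exact hb
  · rw [List.getLast?_cons, H.last]; rfl

theorem Pth.snoc {h : History} {l : List ℕ} {u v y : ℕ} (H : Pth h l u v) (hy : y ∉ l)
    (hb : Bl h v y) : Pth h (l ++ [y]) u y := by
  refine ⟨?_, ?_, ?_, by simp⟩
  · rw [List.nodup_append]
    refine ⟨H.nodup, by simp, ?_⟩
    intro a ha b hb'
    simp at hb'; subst hb'
    rintro rfl; exact hy ha
  · rw [List.isChain_append]
    refine ⟨H.chain, by simp, ?_⟩
    intro x hx z hz
    rw [H.last] at hx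
    simp at hx hz; subst hx; subst hz; exact hb
  · rw [List.head?_append, H.head]; rfl

theorem Pth.head_mem {h : History} {l : List ℕ} {u v : ℕ} (H : Pth h l u v) : u ∈ l :=
  List.mem_of_mem_head? (by rw [H.head]; rfl)

theorem Pth.last_mem {h : History} {l : List ℕ} {u v : ℕ} (H : Pth h l u v) : v ∈ l :=
  List.mem_of_mem_getLast? (by rw [H.last]; rfl)

theorem Pth.tail {h : History} {l : List ℕ} {a b v : ℕ} (H : Pth h (a :: b :: l) a v) :
    Pth h (b :: l) b v ∧ a ∉ b :: l ∧ Bl h a b := by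
  refine ⟨⟨(List.nodup_cons.1 H.nodup).2, H.chain.tail, rfl, ?_⟩,
    (List.nodup_cons.1 H.nodup).1, ?_⟩
  · have := H.last
    rwa [List.getLast?_cons_cons] at this
  · have := H.chain
    rw [List.isChain_cons_cons] at this
    exact this.1

theorem Pth.rotate {h : History} {p q : List ℕ} {u v a : ℕ} (H : Pth h (p ++ a :: q) u v)
    (hb : Bl h v u) : ∃ c, Pth h (a :: q ++ p) a c ∧ Bl h c a := by
  cases p with
  | nil =>
    have h1 := H.head
    simp at h1
    subst h1
    exact ⟨v, by simpa using H, hb⟩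
  | cons x p =>
    have h1 := H.head
    simp at h1
    subst h1
    have hn := H.nodup
    have hc := H.chain
    have hl := H.last
    rw [List.isChain_append] at hc
    have hl' : (a :: q).getLast? = some v := by
      rw [List.getLast?_append] at hl
      simpa using hl
    obtain ⟨c, hcl⟩ : ∃ c, (x :: p).getLast? = some c :=
      ⟨_, List.getLast?_eq_some_getLast (by simp)⟩
    refine ⟨c, ⟨?_, ?_, by simp, ?_⟩, hc.2.2 c hcl a rfl⟩
    · exact (List.perm_append_comm).nodup_iff.1 hn
    · rw [List.isChain_append]
      refine ⟨hc.2.1, hc.1, ?_⟩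
      intro y hy z hz
      rw [hl'] at hy
      simp at hy hz
      subst hy; subst hz; exact hb
    · rw [List.getLast?_append, hcl]; rfl

theorem Pth.won {n : ℕ} {h : History} {l : List ℕ} {u v : ℕ} (H : Pth h l u v)
    (hn : n ≤ l.length) : Won n h := by
  right
  have hstep : ∀ (i : ℕ) (hi : i + 1 < l.length), (blueGraph h).Adj l[i] l[i + 1] := by
    intro i hi
    have hb : Bl h l[i] l[i + 1] := List.isChain_iff_getElem.1 H.chain i hi
    simp only [blueGraph, SimpleGraph.fromEdgeSet_adj]
    refine ⟨hb, ?_⟩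
    intro he
    have := (List.Nodup.getElem_inj_iff H.nodup).1 he
    omega
  refine ⟨⟨fun i => l[i.1]'(by omega), ?_⟩, ?_⟩
  · intro i j hij
    rw [SimpleGraph.pathGraph_adj] at hij
    obtain ⟨i, hi⟩ := i
    obtain ⟨j, hj⟩ := j
    simp only at hij
    rcases hij with rfl | rfl
    · exact hstep i (by omega)
    · exact (hstep j (by omega)).symm
  · intro i j hij
    have := (List.Nodup.getElem_inj_iff H.nodup).1 hij
    exact Fin.ext this

/-- Two consecutive vertices of `l` are in the same red component. -/
def Pair (h : History) (l : List ℕ) : Prop :=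
  ∃ p q a b, l = p ++ a :: b :: q ∧ Re h a b

theorem Pair.mono {h : History} {l : List ℕ} (H : Pair h l) (e : Edge × Bool) :
    Pair (h ++ [e]) l := by
  obtain ⟨p, q, a, b, h1, h2⟩ := H
  exact ⟨p, q, a, b, h1, h2.mono e⟩

theorem Pair.cons {h : History} {l : List ℕ} (H : Pair h l) (y : ℕ) : Pair h (y :: l) := by
  obtain ⟨p, q, a, b, rfl, h2⟩ := H
  exact ⟨y :: p, q, a, b, rfl, h2⟩

theorem Pair.snoc {h : History} {l : List ℕ} (H : Pair h l) (y : ℕ) : Pair h (l ++ [y]) := by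
  obtain ⟨p, q, a, b, rfl, h2⟩ := H
  exact ⟨p, q ++ [y], a, b, by simp, h2⟩

/-- The two kinds of good positions with path on `l`: a blue path with red-connected ends, or a
blue cycle; in both cases with two consecutive vertices that are red-connected. -/
structure GoodPath (h : History) (l : List ℕ) (u v : ℕ) : Prop where
  pth : Pth h l u v
  pair : Pair h l
  ne : u ≠ v
  ends : Re h u v

structure GoodCycle (h : History) (a b : ℕ) (t : List ℕ) (c : ℕ) : Prop where
  pth : Pth h (a :: b :: t) a c
  pair : Re h a b
  ne : t ≠ []
  close : Bl h c a

theorem GoodCycle.of_path {h : History} {l : List ℕ} {u v : ℕ} (H : Pth h l u v)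
    (hp : Pair h l) (hb : Bl h v u) (hl : 3 ≤ l.length) :
    ∃ a b t c, GoodCycle h a b t c ∧ (a :: b :: t).length = l.length := by
  obtain ⟨p, q, a, b, rfl, h2⟩ := hp
  obtain ⟨c, hc1, hc2⟩ := H.rotate hb
  refine ⟨a, b, q ++ p, c, ⟨by simpa using hc1, h2, ?_, hc2⟩, by simp; omega⟩
  intro h0
  simp at h0
  simp [h0] at hl

theorem good_win (n : ℕ) : ∀ m : ℕ, ∀ h : History,
    (∀ l u v, GoodPath h l u v → 2 * n ≤ m + 2 * l.length → CanWin n m h) ∧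
    (∀ a b t c, GoodCycle h a b t c → 2 * n ≤ m + 2 * (t.length + 2) → CanWin n m h) := by
  intro m
  induction m using Nat.strong_induction_on with
  | _ m ih =>
  intro h
  constructor
  · intro l u v H hm
    by_cases hn : n ≤ l.length
    · exact (H.pth.won hn).canWin m
    obtain ⟨m, rfl⟩ : ∃ k, m = k + 1 + 1 := ⟨m - 2, by omega⟩
    have ih' := fun h => ih m (by omega) h
    obtain ⟨y, hyl, hy⟩ := exists_fresh h l
    have hyu : y ≠ u := by rintro rfl; exact hyl H.pth.head_mem
    have hyv : y ≠ v := by rintro rfl; exact hyl H.pth.last_mem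
    have hlen : 2 ≤ l.length := by
      obtain ⟨p, q, a, b, rfl, -⟩ := H.pair
      simp; omega
    have hfr : ∀ c, Free (h ++ [(s(y, u), c)]) y v := by
      intro c
      refine (hy v).append ?_
      simp [hyu, H.ne.symm]
    refine CanWin.move y u hyu (hy u) ?_ ?_
    · have hR := (Re.new h y u).trans (H.ends.mono _)
      refine CanWin.forced y v hyv (hfr _) hR ?_
      refine (ih' _).1 (l ++ [y]) u y ⟨?_, ?_, hyu.symm, ?_⟩ (by simp; omega)
      · exact ((H.pth.mono _).mono _).snoc hyl (Bl.new _ _ _).symm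
      · exact ((H.pair.mono _).mono _).snoc y
      · exact ((Re.new h y u).mono _).symm
    · have hP := (H.pth.mono (s(y, u), false)).cons hyl (Bl.new _ _ _)
      refine CanWin.move y v hyv (hfr _) ?_ ?_
      · refine (ih' _).1 (y :: l) y v ⟨hP.mono _, ((H.pair.mono _).mono _).cons y, hyv, ?_⟩
          (by simp; omega)
        exact Re.new _ _ _
      · obtain ⟨a, b, t, c, hg, hlen'⟩ := GoodCycle.of_path (hP.mono (s(y, v), false))
          (((H.pair.mono _).mono _).cons y) (Bl.new _ _ _).symm (by simp; omega)
        refine (ih' _).2 a b t c hg ?_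
        simp at hlen'
        omega
  · intro a b t c H hm
    by_cases hn : n ≤ t.length + 2
    · exact (H.pth.won (by simpa using hn)).canWin m
    obtain ⟨m, rfl⟩ : ∃ k, m = k + 1 + 1 := ⟨m - 2, by omega⟩
    have ih' := fun h => ih m (by omega) h
    obtain ⟨z, hzl, hz⟩ := exists_fresh h (a :: b :: t)
    obtain ⟨hP, ha, hab⟩ := H.pth.tail
    have hza : z ≠ a := by rintro rfl; simp at hzl
    have hzb : z ≠ b := by rintro rfl; simp at hzl
    have hzc : z ≠ c := by rintro rfl; exact hzl H.pth.last_mem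
    have hca : c ≠ a := by
      rintro rfl; exact ha hP.last_mem
    have hba : b ≠ a := by rintro rfl; simp at ha
    refine CanWin.move z a hza (hz a) ?_ ?_
    · have hR := (Re.new h z a).trans (H.pair.mono _)
      refine CanWin.forced z b hzb ((hz b).append (by simp [hza, hba])) hR ?_
      have hP1 := (hP.snoc ha H.close)
      refine (ih' _).1 (z :: ((b :: t) ++ [a])) z a ⟨?_, ?_, hza, (Re.new _ _ _).mono _⟩
        (by simp; omega)
      · refine ((hP1.mono _).mono _).cons ?_ (Bl.new _ _ _)
        simp at hzl ⊢; tauto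
      · exact ⟨[], t ++ [a], z, b, by simp, hR.mono _⟩
    · refine CanWin.move z c hzc ((hz c).append (by simp [hza, hca])) ?_ ?_
      · refine (ih' _).1 (z :: a :: b :: t) z c ⟨?_, ?_, hzc, Re.new _ _ _⟩ (by simp; omega)
        · exact ((H.pth.mono _).cons hzl (Bl.new _ _ _)).mono _
        · exact ⟨[z], t, a, b, rfl, (H.pair.mono _).mono _⟩
      · refine (ih' _).2 a b (t ++ [z]) z ⟨?_, (H.pair.mono _).mono _, by simp, ?_⟩
          (by simp; omega)
        · exact ((H.pth.mono _).mono _).snoc hzl (Bl.new _ _ _).symm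
        · exact (Bl.new _ _ _).mono _

theorem path_win (n : ℕ) : ∀ m : ℕ, ∀ h : History,
    (∀ l u v, Pth h l u v → u ≠ v → Re h u v → 2 * n + 1 ≤ m + 2 * l.length → CanWin n m h) ∧
    (∀ l u v, Pth h l u v → 3 ≤ l.length → Free h u v →
      2 * n + 3 ≤ m + 2 * l.length → CanWin n m h) := by
  intro m
  induction m using Nat.strong_induction_on with
  | _ m ih =>
  intro h
  constructor
  · intro l u v H huv hR hm
    by_cases hn : n ≤ l.length
    · exact (H.won hn).canWin m
    obtain ⟨m, rfl⟩ : ∃ k, m = k + 1 + 1 + 1 := ⟨m - 3, by omega⟩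
    obtain ⟨y, hyl, hy⟩ := exists_fresh h l
    obtain ⟨z, hzl, hz⟩ := exists_fresh h (y :: l)
    have hyu : y ≠ u := by rintro rfl; exact hyl H.head_mem
    have hyv : y ≠ v := by rintro rfl; exact hyl H.last_mem
    have hzy : z ≠ y := by rintro rfl; simp at hzl
    have hzu : z ≠ u := by rintro rfl; simp [H.head_mem] at hzl
    have hzv : z ≠ v := by rintro rfl; simp [H.last_mem] at hzl
    have hlen : 1 ≤ l.length := List.length_pos_of_mem H.head_mem
    refine CanWin.move y u hyu (hy u) ?_ ?_
    · have hR1 := (Re.new h y u).trans (hR.mono _)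
      refine CanWin.forced y v hyv ((hy v).append (by simp [hyu, huv.symm])) hR1 ?_
      refine (good_win n _ _).1 (l ++ [y]) u y ⟨?_, ?_, hyu.symm, ?_⟩ (by simp; omega)
      · exact ((H.mono _).mono _).snoc hyl (Bl.new _ _ _).symm
      · have hlast := H.last
        rw [List.getLast?_eq_some_iff] at hlast
        obtain ⟨p, rfl⟩ := hlast
        exact ⟨p, [], v, y, by simp, (hR1.mono _).symm⟩
      · exact ((Re.new h y u).mono _).symm
    · have hP := (H.mono (s(y, u), false)).cons hyl (Bl.new _ _ _)
      have hz1 : Fresh (h ++ [(s(y, u), false)]) z := hz.append hzy hzu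
      have hfr : ∀ c, Free (h ++ [(s(y, u), false)] ++ [(s(z, y), c)]) z v := fun c =>
        (hz1 v).append (by simp [hyv.symm, hzy])
      refine CanWin.move z y hzy (hz1 y) ?_ ?_
      · refine CanWin.move z v hzv (hfr _) ?_ ?_
        · have h1 : Re (h ++ [(s(y, u), false)] ++ [(s(z, y), true)] ++ [(s(z, v), true)]) y v :=
            ((Re.new _ z y).mono _).symm.trans (Re.new _ z v)
          refine (good_win n _ _).1 (y :: l) y v ⟨(hP.mono _).mono _, ?_, hyv, h1⟩
            (by simp; omega)
          have hhead := H.head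
          rw [List.head?_eq_some_iff] at hhead
          obtain ⟨q, rfl⟩ := hhead
          exact ⟨[], q, y, u, rfl, h1.trans (((hR.mono _).mono _).mono _).symm⟩
        · refine (ih m (by omega) _).1 ((y :: l) ++ [z]) y z ?_ hzy.symm ?_ (by simp; omega)
          · exact ((hP.mono _).mono _).snoc hzl (Bl.new _ _ _).symm
          · exact ((Re.new _ z y).mono _).symm
      · refine (ih (m + 1) (by omega) _).2 (z :: y :: l) z v ?_ (by simp; omega) (hfr _)
          (by simp; omega)
        exact (hP.mono _).cons hzl (Bl.new _ _ _)
  · intro l u v H hlen hF hm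
    by_cases hn : n ≤ l.length
    · exact (H.won hn).canWin m
    obtain ⟨m, rfl⟩ : ∃ k, m = k + 1 + 1 + 1 := ⟨m - 3, by omega⟩
    obtain ⟨y, hyl, hy⟩ := exists_fresh h l
    have hyu : y ≠ u := by rintro rfl; exact hyl H.head_mem
    have hyv : y ≠ v := by rintro rfl; exact hyl H.last_mem
    have huv : u ≠ v := by
      rintro rfl
      have h1 := H.head
      have h2 := H.last
      have hnd := H.nodup
      match l, hlen with
      | a :: b :: t, _ =>
        simp at h1
        subst h1
        rw [List.getLast?_cons_cons] at h2
        exact (List.nodup_cons.1 hnd).1 (List.mem_of_mem_getLast? h2)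
    have hfr : ∀ c, Free (h ++ [(s(y, u), c)]) y v := fun c =>
      (hy v).append (by simp [hyu, huv.symm])
    refine CanWin.move y u hyu (hy u) ?_ ?_
    · refine CanWin.move y v hyv (hfr _) ?_ ?_
      · have hR : Re (h ++ [(s(y, u), true)] ++ [(s(y, v), true)]) u v :=
          ((Re.new _ y u).mono _).symm.trans (Re.new _ y v)
        refine CanWin.forced u v huv ((hF.append ?_).append ?_) hR ?_
        · simp [hyu.symm, hyv.symm]
        · simp [hyu.symm, hyv.symm]
        · have hP := ((H.mono (s(y, u), true)).mono (s(y, v), true)).mono (s(u, v), false)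
          have hlast := H.last
          rw [List.getLast?_eq_some_iff] at hlast
          obtain ⟨p, rfl⟩ := hlast
          obtain ⟨c, hc1, hc2⟩ := hP.rotate (Bl.new _ _ _).symm
          have hhead := H.head
          match p, hlen with
          | x :: t, hlen =>
            simp at hhead
            subst hhead
            refine (good_win n _ _).2 v x t c ⟨by simpa using hc1, (hR.mono _).symm, ?_, hc2⟩
              (by simp at hm; omega)
            rintro rfl
            simp at hlen
      · refine (ih (m + 1) (by omega) _).1 (l ++ [y]) u y ?_ hyu.symm ?_ (by simp; omega)
        · exact ((H.mono _).mono _).snoc hyl (Bl.new _ _ _).symm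
        · exact ((Re.new _ y u).mono _).symm
    · refine (ih (m + 1 + 1) (by omega) _).2 (y :: l) y v ?_ (by simp; omega) (hfr _)
        (by simp; omega)
      exact (H.mono _).cons hyl (Bl.new _ _ _)

/-! ### The opening -/

theorem opening (n : ℕ) (hn : 8 ≤ n) : CanWin n (2 * n - 2) [] := by
  obtain ⟨m, hm⟩ : ∃ m, 2 * n - 2 = m + 1 + 1 + 1 + 1 + 1 + 1 := ⟨2 * n - 8, by omega⟩
  rw [hm]
  refine CanWin.move 0 1 (by simp) (by simp [Free]) ?_ ?_
  · refine CanWin.move 0 2 (by simp) (by simp [Free]) ?_ ?_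
    · refine CanWin.move 1 3 (by simp) (by simp [Free]) ?_ ?_
      · refine CanWin.forced 0 3 (by simp) (by simp [Free])
          ((Re.of_mem (y := 1) (by simp)).trans (Re.of_mem (y := 3) (by simp))) ?_
        refine CanWin.forced 1 2 (by simp) (by simp [Free])
          ((Re.of_mem (y := 0) (by simp)).trans (Re.of_mem (y := 2) (by simp))) ?_
        refine CanWin.forced 2 3 (by simp) (by simp [Free])
          (((Re.of_mem (y := 0) (by simp)).trans (Re.of_mem (y := 1) (by simp))).trans (Re.of_mem (y := 3) (by simp))) ?_
        exact (good_win n _ _).1 [0, 3, 2, 1] 0 1 ⟨⟨by simp, by simp [Bl], rfl, rfl⟩,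
          ⟨[], [2, 1], 0, 3, rfl, ((Re.of_mem (y := 1) (by simp)).trans (Re.of_mem (y := 3) (by simp)))⟩,
          by simp, (Re.of_mem (y := 1) (by simp))⟩ (by simp; omega)
      · refine CanWin.move 2 3 (by simp) (by simp [Free]) ?_ ?_
        · refine CanWin.forced 0 3 (by simp) (by simp [Free])
            ((Re.of_mem (y := 2) (by simp)).trans (Re.of_mem (y := 3) (by simp))) ?_
          refine CanWin.forced 1 2 (by simp) (by simp [Free])
            ((Re.of_mem (y := 0) (by simp)).trans (Re.of_mem (y := 2) (by simp))) ?_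
          exact (good_win n _ _).1 [0, 3, 1, 2] 0 2 ⟨⟨by simp, by simp [Bl], rfl, rfl⟩,
            ⟨[], [1, 2], 0, 3, rfl, ((Re.of_mem (y := 2) (by simp)).trans (Re.of_mem (y := 3) (by simp)))⟩,
            by simp, (Re.of_mem (y := 2) (by simp))⟩ (by simp; omega)
        · refine CanWin.move 1 4 (by simp) (by simp [Free]) ?_ ?_
          · refine CanWin.forced 2 4 (by simp) (by simp [Free])
              (((Re.of_mem (y := 0) (by simp)).trans (Re.of_mem (y := 1) (by simp))).trans (Re.of_mem (y := 4) (by simp))) ?_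
            exact (good_win n _ _).1 [1, 3, 2, 4] 1 4 ⟨⟨by simp, by simp [Bl], rfl, rfl⟩,
              ⟨[1, 3], [], 2, 4, rfl, (((Re.of_mem (y := 0) (by simp)).trans (Re.of_mem (y := 1) (by simp))).trans (Re.of_mem (y := 4) (by simp)))⟩,
              by simp, (Re.of_mem (y := 4) (by simp))⟩ (by simp; omega)
          · refine CanWin.move 0 4 (by simp) (by simp [Free]) ?_ ?_
            · exact (good_win n _ _).1 [2, 3, 1, 4] 2 4 ⟨⟨by simp, by simp [Bl], rfl, rfl⟩,
                ⟨[2, 3], [], 1, 4, rfl, ((Re.of_mem (y := 0) (by simp)).trans (Re.of_mem (y := 4) (by simp)))⟩,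
                by simp, ((Re.of_mem (y := 0) (by simp)).trans (Re.of_mem (y := 4) (by simp)))⟩ (by simp; omega)
            · exact (path_win n _ _).1 [0, 4, 1, 3, 2] 0 2 ⟨by simp, by simp [Bl], rfl, rfl⟩ (by simp)
                (Re.of_mem (y := 2) (by simp)) (by simp; omega)
    · refine CanWin.move 1 3 (by simp) (by simp [Free]) ?_ ?_
      · refine CanWin.move 2 3 (by simp) (by simp [Free]) ?_ ?_
        · refine CanWin.forced 0 3 (by simp) (by simp [Free])
            ((Re.of_mem (y := 1) (by simp)).trans (Re.of_mem (y := 3) (by simp))) ?_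
          refine CanWin.forced 1 2 (by simp) (by simp [Free])
            ((Re.of_mem (y := 3) (by simp)).trans (Re.of_mem (y := 2) (by simp))) ?_
          exact (good_win n _ _).1 [1, 2, 0, 3] 1 3 ⟨⟨by simp, by simp [Bl], rfl, rfl⟩,
            ⟨[], [0, 3], 1, 2, rfl, ((Re.of_mem (y := 3) (by simp)).trans (Re.of_mem (y := 2) (by simp)))⟩,
            by simp, (Re.of_mem (y := 3) (by simp))⟩ (by simp; omega)
        · refine CanWin.move 0 4 (by simp) (by simp [Free]) ?_ ?_
          · refine CanWin.forced 3 4 (by simp) (by simp [Free])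
              (((Re.of_mem (y := 1) (by simp)).trans (Re.of_mem (y := 0) (by simp))).trans (Re.of_mem (y := 4) (by simp))) ?_
            exact (good_win n _ _).1 [0, 2, 3, 4] 0 4 ⟨⟨by simp, by simp [Bl], rfl, rfl⟩,
              ⟨[0, 2], [], 3, 4, rfl, (((Re.of_mem (y := 1) (by simp)).trans (Re.of_mem (y := 0) (by simp))).trans (Re.of_mem (y := 4) (by simp)))⟩,
              by simp, (Re.of_mem (y := 4) (by simp))⟩ (by simp; omega)
          · refine CanWin.move 1 4 (by simp) (by simp [Free]) ?_ ?_
            · exact (good_win n _ _).1 [3, 2, 0, 4] 3 4 ⟨⟨by simp, by simp [Bl], rfl, rfl⟩,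
                ⟨[3, 2], [], 0, 4, rfl, ((Re.of_mem (y := 1) (by simp)).trans (Re.of_mem (y := 4) (by simp)))⟩,
                by simp, ((Re.of_mem (y := 1) (by simp)).trans (Re.of_mem (y := 4) (by simp)))⟩ (by simp; omega)
            · exact (path_win n _ _).1 [1, 4, 0, 2, 3] 1 3 ⟨by simp, by simp [Bl], rfl, rfl⟩ (by simp)
                (Re.of_mem (y := 3) (by simp)) (by simp; omega)
      · refine CanWin.move 0 3 (by simp) (by simp [Free]) ?_ ?_
        · refine CanWin.move 1 2 (by simp) (by simp [Free]) ?_ ?_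
          · refine CanWin.forced 2 3 (by simp) (by simp [Free])
              (((Re.of_mem (y := 1) (by simp)).trans (Re.of_mem (y := 0) (by simp))).trans (Re.of_mem (y := 3) (by simp))) ?_
            exact (good_win n _ _).1 [0, 2, 3, 1] 0 1 ⟨⟨by simp, by simp [Bl], rfl, rfl⟩,
              ⟨[], [3, 1], 0, 2, rfl, ((Re.of_mem (y := 1) (by simp)).trans (Re.of_mem (y := 2) (by simp)))⟩,
              by simp, (Re.of_mem (y := 1) (by simp))⟩ (by simp; omega)
          · exact (good_win n _ _).1 [0, 2, 1, 3] 0 3 ⟨⟨by simp, by simp [Bl], rfl, rfl⟩,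
              ⟨[0, 2], [], 1, 3, rfl, ((Re.of_mem (y := 0) (by simp)).trans (Re.of_mem (y := 3) (by simp)))⟩,
              by simp, (Re.of_mem (y := 3) (by simp))⟩ (by simp; omega)
        · refine CanWin.move 1 4 (by simp) (by simp [Free]) ?_ ?_
          · refine CanWin.forced 0 4 (by simp) (by simp [Free])
              ((Re.of_mem (y := 1) (by simp)).trans (Re.of_mem (y := 4) (by simp))) ?_
            exact (good_win n _ _).1 [1, 3, 0, 4] 1 4 ⟨⟨by simp, by simp [Bl], rfl, rfl⟩,
              ⟨[1, 3], [], 0, 4, rfl, ((Re.of_mem (y := 1) (by simp)).trans (Re.of_mem (y := 4) (by simp)))⟩,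
              by simp, (Re.of_mem (y := 4) (by simp))⟩ (by simp; omega)
          · exact (path_win n _ _).2 [2, 0, 3, 1, 4] 2 4 ⟨by simp, by simp [Bl], rfl, rfl⟩
              (by simp) (by simp [Free]) (by simp; omega)
  · refine CanWin.move 0 2 (by simp) (by simp [Free]) ?_ ?_
    · refine CanWin.move 2 3 (by simp) (by simp [Free]) ?_ ?_
      · refine CanWin.move 1 3 (by simp) (by simp [Free]) ?_ ?_
        · refine CanWin.forced 0 3 (by simp) (by simp [Free])
            ((Re.of_mem (y := 2) (by simp)).trans (Re.of_mem (y := 3) (by simp))) ?_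
          refine CanWin.forced 1 2 (by simp) (by simp [Free])
            ((Re.of_mem (y := 3) (by simp)).trans (Re.of_mem (y := 2) (by simp))) ?_
          exact (good_win n _ _).1 [2, 1, 0, 3] 2 3 ⟨⟨by simp, by simp [Bl], rfl, rfl⟩,
            ⟨[], [0, 3], 2, 1, rfl, ((Re.of_mem (y := 3) (by simp)).trans (Re.of_mem (y := 1) (by simp)))⟩,
            by simp, (Re.of_mem (y := 3) (by simp))⟩ (by simp; omega)
        · refine CanWin.move 0 4 (by simp) (by simp [Free]) ?_ ?_
          · refine CanWin.forced 3 4 (by simp) (by simp [Free])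
              (((Re.of_mem (y := 2) (by simp)).trans (Re.of_mem (y := 0) (by simp))).trans (Re.of_mem (y := 4) (by simp))) ?_
            exact (good_win n _ _).1 [0, 1, 3, 4] 0 4 ⟨⟨by simp, by simp [Bl], rfl, rfl⟩,
              ⟨[0, 1], [], 3, 4, rfl, (((Re.of_mem (y := 2) (by simp)).trans (Re.of_mem (y := 0) (by simp))).trans (Re.of_mem (y := 4) (by simp)))⟩,
              by simp, (Re.of_mem (y := 4) (by simp))⟩ (by simp; omega)
          · refine CanWin.move 2 4 (by simp) (by simp [Free]) ?_ ?_
            · exact (good_win n _ _).1 [3, 1, 0, 4] 3 4 ⟨⟨by simp, by simp [Bl], rfl, rfl⟩,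
                ⟨[3, 1], [], 0, 4, rfl, ((Re.of_mem (y := 2) (by simp)).trans (Re.of_mem (y := 4) (by simp)))⟩,
                by simp, ((Re.of_mem (y := 2) (by simp)).trans (Re.of_mem (y := 4) (by simp)))⟩ (by simp; omega)
            · exact (path_win n _ _).1 [2, 4, 0, 1, 3] 2 3 ⟨by simp, by simp [Bl], rfl, rfl⟩ (by simp)
                (Re.of_mem (y := 3) (by simp)) (by simp; omega)
      · refine CanWin.move 0 3 (by simp) (by simp [Free]) ?_ ?_
        · refine CanWin.move 1 2 (by simp) (by simp [Free]) ?_ ?_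
          · refine CanWin.forced 1 3 (by simp) (by simp [Free])
              (((Re.of_mem (y := 2) (by simp)).trans (Re.of_mem (y := 0) (by simp))).trans (Re.of_mem (y := 3) (by simp))) ?_
            exact (good_win n _ _).1 [0, 1, 3, 2] 0 2 ⟨⟨by simp, by simp [Bl], rfl, rfl⟩,
              ⟨[], [3, 2], 0, 1, rfl, ((Re.of_mem (y := 2) (by simp)).trans (Re.of_mem (y := 1) (by simp)))⟩,
              by simp, (Re.of_mem (y := 2) (by simp))⟩ (by simp; omega)
          · exact (good_win n _ _).1 [0, 1, 2, 3] 0 3 ⟨⟨by simp, by simp [Bl], rfl, rfl⟩,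
              ⟨[0, 1], [], 2, 3, rfl, ((Re.of_mem (y := 0) (by simp)).trans (Re.of_mem (y := 3) (by simp)))⟩,
              by simp, (Re.of_mem (y := 3) (by simp))⟩ (by simp; omega)
        · refine CanWin.move 1 4 (by simp) (by simp [Free]) ?_ ?_
          · refine CanWin.move 2 4 (by simp) (by simp [Free]) ?_ ?_
            · exact (good_win n _ _).1 [1, 0, 3, 2] 1 2 ⟨⟨by simp, by simp [Bl], rfl, rfl⟩,
                ⟨[], [3, 2], 1, 0, rfl, (((Re.of_mem (y := 4) (by simp)).trans (Re.of_mem (y := 2) (by simp))).trans (Re.of_mem (y := 0) (by simp)))⟩,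
                by simp, ((Re.of_mem (y := 4) (by simp)).trans (Re.of_mem (y := 2) (by simp)))⟩ (by simp; omega)
            · exact (path_win n _ _).1 [1, 0, 3, 2, 4] 1 4 ⟨by simp, by simp [Bl], rfl, rfl⟩ (by simp)
                (Re.of_mem (y := 4) (by simp)) (by simp; omega)
          · exact (path_win n _ _).2 [2, 3, 0, 1, 4] 2 4 ⟨by simp, by simp [Bl], rfl, rfl⟩
              (by simp) (by simp [Free]) (by simp; omega)
    · refine CanWin.move 1 3 (by simp) (by simp [Free]) ?_ ?_
      · refine CanWin.move 2 3 (by simp) (by simp [Free]) ?_ ?_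
        · refine CanWin.move 1 4 (by simp) (by simp [Free]) ?_ ?_
          · refine CanWin.forced 2 4 (by simp) (by simp [Free])
              (((Re.of_mem (y := 3) (by simp)).trans (Re.of_mem (y := 1) (by simp))).trans (Re.of_mem (y := 4) (by simp))) ?_
            exact (good_win n _ _).1 [1, 0, 2, 4] 1 4 ⟨⟨by simp, by simp [Bl], rfl, rfl⟩,
              ⟨[1, 0], [], 2, 4, rfl, (((Re.of_mem (y := 3) (by simp)).trans (Re.of_mem (y := 1) (by simp))).trans (Re.of_mem (y := 4) (by simp)))⟩,
              by simp, (Re.of_mem (y := 4) (by simp))⟩ (by simp; omega)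
          · refine CanWin.move 3 4 (by simp) (by simp [Free]) ?_ ?_
            · exact (good_win n _ _).1 [2, 0, 1, 4] 2 4 ⟨⟨by simp, by simp [Bl], rfl, rfl⟩,
                ⟨[2, 0], [], 1, 4, rfl, ((Re.of_mem (y := 3) (by simp)).trans (Re.of_mem (y := 4) (by simp)))⟩,
                by simp, ((Re.of_mem (y := 3) (by simp)).trans (Re.of_mem (y := 4) (by simp)))⟩ (by simp; omega)
            · exact (path_win n _ _).1 [2, 0, 1, 4, 3] 2 3 ⟨by simp, by simp [Bl], rfl, rfl⟩ (by simp)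
                (Re.of_mem (y := 3) (by simp)) (by simp; omega)
        · exact (path_win n _ _).1 [1, 0, 2, 3] 1 3 ⟨by simp, by simp [Bl], rfl, rfl⟩ (by simp)
            (Re.of_mem (y := 3) (by simp)) (by simp; omega)
      · exact (path_win n _ _).2 [2, 0, 1, 3] 2 3 ⟨by simp, by simp [Bl], rfl, rfl⟩
          (by simp) (by simp [Free]) (by simp; omega)

/-! ### The lower bound -/

open Classical in
/-- Painter colours red unless this closes a red cycle. -/
noncomputable def greedy : PainterStrat := fun h e =>
  decide ((redGraph (h ++ [(e, true)])).IsAcyclic)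

theorem redGraph_append_false (h : History) (e : Edge) :
    redGraph (h ++ [(e, false)]) = redGraph h := by
  have : redSet (h ++ [(e, false)]) = redSet h := by
    ext x; simp [redSet]
  unfold redGraph
  rw [this]

theorem redGraph_append_true (h : History) (x y : ℕ) :
    redGraph (h ++ [(s(x, y), true)]) = redGraph h ⊔ SimpleGraph.edge x y := by
  have : redSet (h ++ [(s(x, y), true)]) = redSet h ∪ {s(x, y)} := by
    ext z; simp [redSet, or_comm]
  unfold redGraph SimpleGraph.edge
  rw [this, SimpleGraph.fromEdgeSet_union]

theorem greedy_inv (B : BuilderStrat) (t : ℕ) :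
    (redGraph (gamePlay B greedy t)).IsAcyclic ∧
    ∀ x y, Bl (gamePlay B greedy t) x y → Re (gamePlay B greedy t) x y := by
  induction t with
  | zero =>
    refine ⟨?_, ?_⟩
    · have : redGraph (gamePlay B greedy 0) = ⊥ := by
        ext x y; simp [redGraph, redSet, gamePlay]
      rw [this]; exact SimpleGraph.isAcyclic_bot
    · intro x y hb
      simp [Bl, gamePlay] at hb
  | succ t ih =>
    obtain ⟨ih1, ih2⟩ := ih
    simp only [gamePlay]
    generalize gamePlay B greedy t = h at *
    generalize B h = e
    by_cases hac : (redGraph (h ++ [(e, true)])).IsAcyclic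
    · have hg : greedy h e = true := by simp [greedy, hac]
      rw [hg]
      refine ⟨hac, ?_⟩
      intro x y hb
      have : Bl h x y := by simpa [Bl] using hb
      exact (ih2 x y this).mono _
    · have hg : greedy h e = false := by simp [greedy, hac]
      rw [hg]
      refine ⟨by rw [redGraph_append_false]; exact ih1, ?_⟩
      intro x y hb
      have hb' : Bl h x y ∨ s(x, y) = e := by simpa [Bl] using hb
      rcases hb' with hb' | rfl
      · exact (ih2 x y hb').mono _
      · refine Re.mono ?_ _
        by_contra hre
        apply hac
        rw [redGraph_append_true]
        exact SimpleGraph.IsAcyclic.sup_edge_of_not_reachable hre ih1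

theorem red_count (h : History) (V : Finset ℕ) (v : ℕ)
    (hV : ∀ x ∈ V, Re h v x) : V.card ≤ ((h.filter (fun p => p.2)).map Prod.fst).toFinset.card + 1 := by
  set S := ((h.filter (fun p => p.2)).map Prod.fst).toFinset with hS
  have hmem : ∀ e, e ∈ S ↔ (e, true) ∈ h := by
    intro e; simp [hS]
  let C := (redGraph h).connectedComponentMk v
  have hconn : (C.toSimpleGraph).Connected := C.connected_toSimpleGraph
  have h1 := hconn.card_vert_le_card_edgeSet_add_one
  have hfin : (C.supp).Finite := by
    refine Set.Finite.subset (s := insert v (⋃ e ∈ S, {x : ℕ | x ∈ e})) ?_ ?_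
    · refine Set.Finite.insert _ (Set.Finite.biUnion S.finite_toSet ?_)
      intro e _
      induction e using Sym2.ind with
      | _ a b =>
        refine Set.Finite.subset (Set.toFinite {a, b}) ?_
        intro x hx
        simpa using hx
    · intro x hx
      by_cases hxv : x = v
      · simp [hxv]
      right
      have hr : (redGraph h).Reachable x v := SimpleGraph.ConnectedComponent.exact hx
      obtain ⟨p⟩ := hr
      cases p with
      | nil => exact absurd rfl hxv
      | @cons _ w _ hadj _ =>
        simp only [redGraph, SimpleGraph.fromEdgeSet_adj] at hadj
        simp only [Set.mem_iUnion]
        exact ⟨s(x, w), (hmem _).2 hadj.1, by simp⟩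
  have h2 : V.card ≤ Nat.card C.supp := by
    rw [Nat.card_coe_set_eq, ← Set.ncard_coe_finset]
    refine Set.ncard_le_ncard ?_ hfin
    intro x hx
    exact SimpleGraph.ConnectedComponent.sound (hV x hx).symm
  have h3 : Nat.card C.toSimpleGraph.edgeSet ≤ S.card := by
    have hcS : Nat.card (S : Set Edge) = S.card := by simp
    rw [← hcS]
    refine Nat.card_le_card_of_injective
      (fun e : C.toSimpleGraph.edgeSet => (⟨Sym2.map Subtype.val e.1, ?_⟩ : (S : Set Edge))) ?_
    · obtain ⟨e, he⟩ := e
      induction e using Sym2.ind with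
      | _ a b =>
        have hadj : (redGraph h).Adj a b := he
        simp only [redGraph, SimpleGraph.fromEdgeSet_adj] at hadj
        exact (hmem _).2 hadj.1
    · intro e e' hee
      have := congrArg Subtype.val hee
      exact Subtype.ext (Sym2.map.injective Subtype.val_injective this)
  exact h2.trans (h1.trans (by omega))

theorem blue_count (n : ℕ) (h : History) (H : HasCopy (SimpleGraph.pathGraph n) (blueGraph h)) :
    n ≤ ((h.filter (fun p => !p.2)).map Prod.fst).toFinset.card + 1 := by
  obtain ⟨f, hf⟩ := H
  obtain _ | n := n
  · omega
  have key : (Finset.univ : Finset (Fin n)).card ≤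
      ((h.filter (fun p => !p.2)).map Prod.fst).toFinset.card := by
    refine Finset.card_le_card_of_injOn (fun i => s(f i.castSucc, f i.succ)) ?_ ?_
    · intro i _
      have hadj : (SimpleGraph.pathGraph (n + 1)).Adj i.castSucc i.succ := by
        rw [SimpleGraph.pathGraph_adj]; simp
      have h2 := f.map_adj hadj
      simp only [blueGraph, SimpleGraph.fromEdgeSet_adj] at h2
      have h3 : (s(f i.castSucc, f i.succ), false) ∈ h := h2.1
      simp [h3]
    · intro i _ j _ hij
      simp only [Sym2.eq_iff, hf.eq_iff] at hij
      rcases hij with ⟨h1, _⟩ | ⟨h1, h2⟩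
      · exact Fin.castSucc_injective _ h1
      · simp only [Fin.ext_iff, Fin.val_castSucc, Fin.val_succ] at h1 h2
        omega
  simpa using key

theorem greedy_noPath (n : ℕ) (hn : 8 ≤ n) (B : BuilderStrat) :
    ¬ HasCopy (SimpleGraph.pathGraph n) (blueGraph (gamePlay B greedy (2 * n - 3))) := by
  intro H
  have hb := blue_count n _ H
  obtain ⟨_, hinv⟩ := greedy_inv B (2 * n - 3)
  have hlen := gamePlay_length B greedy (2 * n - 3)
  generalize gamePlay B greedy (2 * n - 3) = h at *
  obtain ⟨f, hf⟩ := H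
  obtain ⟨k, rfl⟩ : ∃ k, n = k + 1 := ⟨n - 1, by omega⟩
  have hr := red_count h (Finset.univ.image f) (f 0) (by
    intro x hx
    simp only [Finset.mem_image, Finset.mem_univ, true_and] at hx
    obtain ⟨i, rfl⟩ := hx
    induction i using Fin.induction with
    | zero => exact SimpleGraph.Reachable.refl _
    | succ i ih =>
      have hadj : (SimpleGraph.pathGraph (k + 1)).Adj i.castSucc i.succ := by
        rw [SimpleGraph.pathGraph_adj]; simp
      have h2 := f.map_adj hadj
      simp only [blueGraph, SimpleGraph.fromEdgeSet_adj] at h2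
      exact ih.trans (hinv _ _ h2.1))
  rw [Finset.card_image_of_injective _ hf, Finset.card_univ, Fintype.card_fin] at hr
  have c1 := List.toFinset_card_le ((h.filter (fun p => p.2)).map Prod.fst)
  have c2 := List.toFinset_card_le ((h.filter (fun p => !p.2)).map Prod.fst)
  rw [List.length_map] at c1 c2
  have c3 := List.length_eq_length_filter_add (l := h) (fun p => p.2)
  omega

/-- For every `n ≥ 8`, `r̃(𝒞, Pₙ) = 2n - 2`: Builder can force the red graph to
contain a cycle (of any length) or the blue graph to contain a path on `n` vertices
within `2n - 2` rounds, while for every Builder strategy some Painter strategy keeps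
the red graph acyclic and the blue graph free of `Pₙ` for `2n - 3` rounds. -/
theorem onlineRamsey_anyCycle_path_eq (n : ℕ) (hn : 8 ≤ n) :
    (∃ B : BuilderStrat, BuilderLegal B (2 * n - 2) ∧
      ∀ P : PainterStrat, ∃ t ≤ 2 * n - 2,
        ¬ (redGraph (gamePlay B P t)).IsAcyclic ∨
          HasCopy (SimpleGraph.pathGraph n) (blueGraph (gamePlay B P t))) ∧
    ∀ B : BuilderStrat, BuilderLegal B (2 * n - 3) →
      ∃ P : PainterStrat,
        (redGraph (gamePlay B P (2 * n - 3))).IsAcyclic ∧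
        ¬ HasCopy (SimpleGraph.pathGraph n) (blueGraph (gamePlay B P (2 * n - 3))) := by
  refine ⟨⟨bstrat n (2 * n - 2), fun P t _ => bstrat_legal n _ _,
    fun P => bstrat_wins n _ (opening n hn) P⟩, ?_⟩
  intro B _
  exact ⟨greedy, (greedy_inv B _).1, greedy_noPath n hn B⟩

end OnlineRamsey
end

section
/- Let s ≥ 2 and let H be an (s,s)-butterfly with centres (u0,u1). Then there exist vertices x ∈ {x1,…,xs}, y ∈ {y1,…,ys} and a path Q in the complete graph on V(H) whose vertex set is exactly V(H) ∖ {u0,u1}, whose ends are x and y, and each of whose edges joins two vertices that are the ends of a path with exactly three edges in H (in particular, no edge of Q is an edge of H). -/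
/-!
The `(p, q)`-butterfly with centres `(u₀, u₁)`, realised as a graph on `ℕ` with
`u₀ = 0`, `u₁ = 1`, `u₂ = 2`, `u₃ = 3`, `u₄ = 4`, `u₅ = 5`, wing vertices
`xᵢ = 5 + i` (`1 ≤ i ≤ p`) and `yⱼ = 5 + p + j` (`1 ≤ j ≤ q`): its edges are those
of the path `u₄u₂u₀u₁u₃u₅` together with the `u₀`-wing edges `u₀xᵢ` and the
`u₁`-wing edges `u₁yⱼ`.  Its vertex set is `{0, 1, …, 5 + p + q}`.
-/

namespace Butterfly

/-- The edges of the `(p, q)`-butterfly. -/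
def butterflyEdges (p q : ℕ) : Set (Sym2 ℕ) :=
  {s(4, 2), s(2, 0), s(0, 1), s(1, 3), s(3, 5)} ∪
    {e | ∃ i : ℕ, 1 ≤ i ∧ i ≤ p ∧ e = s(0, 5 + i)} ∪
    {e | ∃ j : ℕ, 1 ≤ j ∧ j ≤ q ∧ e = s(1, 5 + p + j)}

/-- The `(p, q)`-butterfly with centres `(0, 1)`, as a simple graph on `ℕ`. -/
def butterfly (p q : ℕ) : SimpleGraph ℕ :=
  SimpleGraph.fromEdgeSet (butterflyEdges p q)

/-- `x` and `y` are the two ends of a path with exactly three edges in `H`. -/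
def Linked3 (H : SimpleGraph ℕ) (x y : ℕ) : Prop :=
  ∃ a b : ℕ, H.Adj x a ∧ H.Adj a b ∧ H.Adj b y ∧ x ≠ b ∧ a ≠ y ∧ x ≠ y

theorem adj_iff (p a b : ℕ) : (butterfly p p).Adj a b ↔ s(a, b) ∈ butterflyEdges p p ∧ a ≠ b := by
  simp [butterfly]

theorem adj01 (p : ℕ) : (butterfly p p).Adj 0 1 := by
  rw [adj_iff]; simp [butterflyEdges]

theorem adj02 (p : ℕ) : (butterfly p p).Adj 0 2 := by
  rw [adj_iff]; simp [butterflyEdges]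

theorem adj24 (p : ℕ) : (butterfly p p).Adj 2 4 := by
  rw [adj_iff]; simp [butterflyEdges]

theorem adj13 (p : ℕ) : (butterfly p p).Adj 1 3 := by
  rw [adj_iff]; simp [butterflyEdges]

theorem adj35 (p : ℕ) : (butterfly p p).Adj 3 5 := by
  rw [adj_iff]; simp [butterflyEdges]

theorem adj0x (p x : ℕ) (h : 6 ≤ x) (h' : x ≤ 5 + p) : (butterfly p p).Adj 0 x := by
  rw [adj_iff]
  refine ⟨Or.inl (Or.inr ⟨x - 5, by omega, by omega, ?_⟩), by omega⟩
  rw [show 5 + (x - 5) = x by omega]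

theorem adj1y (p y : ℕ) (h : 6 + p ≤ y) (h' : y ≤ 5 + p + p) : (butterfly p p).Adj 1 y := by
  rw [adj_iff]
  refine ⟨Or.inr ⟨y - (5 + p), by omega, by omega, ?_⟩, by omega⟩
  rw [show 5 + p + (y - (5 + p)) = y by omega]

theorem linked_symm {H : SimpleGraph ℕ} {x y : ℕ} (h : Linked3 H x y) : Linked3 H y x := by
  obtain ⟨a, b, h1, h2, h3, h4, h5, h6⟩ := h
  exact ⟨b, a, h3.symm, h2.symm, h1.symm, h5.symm, h4.symm, h6.symm⟩

theorem linked_xy (p x y : ℕ) (h : 6 ≤ x) (h' : x ≤ 5 + p) (k : 6 + p ≤ y) (k' : y ≤ 5 + p + p) :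
    Linked3 (butterfly p p) x y :=
  ⟨0, 1, (adj0x p x h h').symm, adj01 p, adj1y p y k k', by omega, by omega, by omega⟩

theorem linked_x4 (p x : ℕ) (h : 6 ≤ x) (h' : x ≤ 5 + p) : Linked3 (butterfly p p) x 4 :=
  ⟨0, 2, (adj0x p x h h').symm, adj02 p, adj24 p, by omega, by omega, by omega⟩

theorem linked_x3 (p x : ℕ) (h : 6 ≤ x) (h' : x ≤ 5 + p) : Linked3 (butterfly p p) x 3 :=
  ⟨0, 1, (adj0x p x h h').symm, adj01 p, adj13 p, by omega, by omega, by omega⟩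

theorem linked_32 (p : ℕ) : Linked3 (butterfly p p) 3 2 :=
  ⟨1, 0, (adj13 p).symm, (adj01 p).symm, adj02 p, by omega, by omega, by omega⟩

theorem linked_2y (p y : ℕ) (k : 6 + p ≤ y) (k' : y ≤ 5 + p + p) : Linked3 (butterfly p p) 2 y :=
  ⟨0, 1, (adj02 p).symm, adj01 p, adj1y p y k k', by omega, by omega, by omega⟩

theorem linked_5y (p y : ℕ) (k : 6 + p ≤ y) (k' : y ≤ 5 + p + p) : Linked3 (butterfly p p) 5 y :=
  ⟨3, 1, (adj35 p).symm, (adj13 p).symm, adj1y p y k k', by omega, by omega, by omega⟩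

theorem build (p k : ℕ) (hk : k + 2 ≤ p) : ∃ l : List ℕ, l.Nodup ∧
    (∀ v, v ∈ l ↔ (2 ≤ v ∧ v ≤ 7 + k) ∨ (6 + p ≤ v ∧ v ≤ 7 + p + k)) ∧
    l.head? = some 6 ∧ l.getLast? = some (7 + p + k) ∧
    l.IsChain (Linked3 (butterfly p p)) := by
  induction k with
  | zero =>
    refine ⟨[6, 4, 7, 3, 2, 6 + p, 5, 7 + p], ?_, ?_, by simp, by simp, ?_⟩
    · simp; omega
    · intro v; simp; omega
    · simp only [List.isChain_cons_cons, List.isChain_singleton, and_true]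
      exact ⟨linked_x4 p 6 (by omega) (by omega), linked_symm (linked_x4 p 7 (by omega) (by omega)),
        linked_x3 p 7 (by omega) (by omega), linked_32 p, linked_2y p _ (by omega) (by omega),
        linked_symm (linked_5y p _ (by omega) (by omega)), linked_5y p _ (by omega) (by omega)⟩
  | succ k ih =>
    obtain ⟨l, h1, h2, h3, h4, h5⟩ := ih (by omega)
    refine ⟨l ++ [8 + k, 8 + p + k], ?_, ?_, by simp [h3], by simp; omega, ?_⟩
    · rw [List.nodup_append]
      refine ⟨h1, by simp; omega, ?_⟩
      intro a ha b hb
      rw [h2] at ha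
      simp at hb
      omega
    · intro v
      rw [List.mem_append, h2]
      simp
      omega
    · rw [List.isChain_append]
      refine ⟨h5, ?_, ?_⟩
      · simp only [List.isChain_cons_cons, List.isChain_singleton, and_true]
        exact linked_xy p _ _ (by omega) (by omega) (by omega) (by omega)
      · intro a ha b hb
        rw [h4] at ha
        simp at ha hb
        subst ha hb
        exact linked_symm (linked_xy p _ _ (by omega) (by omega) (by omega) (by omega))

/-- For `p ≥ 2` there are a vertex `x` of the `u₀`-wing and a vertex `y` of the
`u₁`-wing of the `(p, p)`-butterfly `H`, and a path `Q` in the complete graph on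
`V(H)` that visits exactly the vertices of `V(H) ∖ {u₀, u₁}`, has ends `x` and `y`,
and each of whose edges joins two vertices that are the ends of a path with exactly
three edges in `H`. -/
theorem butterfly_spanning_path_wing_wing (p : ℕ) (hp : 2 ≤ p) :
    ∃ x y : ℕ, 6 ≤ x ∧ x ≤ 5 + p ∧ 6 + p ≤ y ∧ y ≤ 5 + p + p ∧
      ∃ l : List ℕ, l.Nodup ∧
        l.toFinset = ((Finset.range (6 + p + p)).erase 0).erase 1 ∧
        l.head? = some x ∧ l.getLast? = some y ∧
        l.Chain' (Linked3 (butterfly p p)) := by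
  obtain ⟨l, h1, h2, h3, h4, h5⟩ := build p (p - 2) (by omega)
  refine ⟨6, 7 + p + (p - 2), by omega, by omega, by omega, by omega, l, h1, ?_, h3, h4, h5⟩
  ext v
  rw [List.mem_toFinset, h2]
  simp only [Finset.mem_erase, Finset.mem_range]
  omega

end Butterfly
end
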